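/- arXiv:math/0410368 — 2 statements merged into one kernel-verified Lean document; each statement's English description precedes it below -/
import Mathlib

section
/- For every abelian group G and every prime p, the following three conditions are equivalent: (i) G is p-divisible; (ii) Ext(ℤ(p^∞), G) is p-divisible; (iii) Ext(ℤ(p^∞), G) = 0. -/
/-- Subgroup of elements annihilated by a power of `p`. -/
def pTorsion (p : ℕ) (A : Type) [AddCommGroup A] : AddSubgroup A where
  carrier := {a | ∃ k : ℕ, p ^ k • a = 0}
  zero_mem' := ⟨0, smul_zero _⟩
  add_mem' := by
    rintro a b ⟨k, hk⟩ ⟨l, hl⟩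
    refine ⟨k + l, ?_⟩
    have h1 : p ^ (k + l) • a = 0 := by rw [pow_add, mul_comm, mul_smul, hk, smul_zero]
    have h2 : p ^ (k + l) • b = 0 := by rw [pow_add, mul_smul, hl, smul_zero]
    rw [smul_add, h1, h2, add_zero]
  neg_mem' := by
    rintro a ⟨k, hk⟩
    exact ⟨k, by rw [smul_neg, hk, neg_zero]⟩

/-- The Prüfer `p`-group, realized as the `p`-primary torsion subgroup of `ℚ/ℤ`. -/
abbrev PruferGroup (p : ℕ) : AddSubgroup (ℚ ⧸ AddSubgroup.zmultiples (1 : ℚ)) :=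
  pTorsion p (ℚ ⧸ AddSubgroup.zmultiples (1 : ℚ))

noncomputable def ExtPrufer (p : ℕ) (G : Type) [AddCommGroup G] : Type :=
  ((Ext ℤ (ModuleCat ℤ) 1).obj (Opposite.op (ModuleCat.of ℤ (PruferGroup p)))).obj
    (ModuleCat.of ℤ G)

noncomputable instance (p : ℕ) (G : Type) [AddCommGroup G] : AddCommGroup (ExtPrufer p G) := by
  unfold ExtPrufer; infer_instance

open CategoryTheory Limits ZeroObject

namespace CategoryTheory.ShortComplex

variable {C : Type*} [Category* C] [Abelian C] (S : ShortComplex C)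

/-- The objects of `S.twoTermComplex`. -/
noncomputable def twoTermX : ℕ → C
  | 0 => S.X₂
  | 1 => S.X₁
  | _ + 2 => 0

/-- The differentials of `S.twoTermComplex`. -/
noncomputable def twoTermD : ∀ n, S.twoTermX (n + 1) ⟶ S.twoTermX n
  | 0 => S.f
  | _ + 1 => 0

/-- The chain complex `⋯ ⟶ 0 ⟶ S.X₁ ⟶ S.X₂`. -/
noncomputable def twoTermComplex : ChainComplex C ℕ :=
  ChainComplex.of S.twoTermX S.twoTermD (fun _ => zero_comp)

lemma twoTermComplex_d_one_zero : S.twoTermComplex.d 1 0 = S.f :=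
  ChainComplex.of_d S.twoTermX S.twoTermD 0

lemma twoTermComplex_d_two_one : S.twoTermComplex.d 2 1 = 0 :=
  ChainComplex.of_d S.twoTermX S.twoTermD 1

instance [Projective S.X₁] [Projective S.X₂] : ∀ n, Projective (S.twoTermComplex.X n)
  | 0 => inferInstanceAs (Projective S.X₂)
  | 1 => inferInstanceAs (Projective S.X₁)
  | _ + 2 => inferInstanceAs (Projective (0 : C))

variable {S}

lemma ShortExact.twoTermComplex_exactAt_succ (hS : S.ShortExact) (n : ℕ) :
    S.twoTermComplex.ExactAt (n + 1) := by
  rw [HomologicalComplex.exactAt_iff' _ (n + 2) (n + 1) n (by simp) (by simp)]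
  cases n with
  | zero =>
    refine (ShortComplex.exact_iff_mono _ S.twoTermComplex_d_two_one).2 ?_
    change Mono (S.twoTermComplex.d 1 0)
    rw [twoTermComplex_d_one_zero]
    exact hS.mono_f
  | succ n => exact ShortComplex.exact_of_isZero_X₂ _ (isZero_zero C)

/-- The augmentation of `S.twoTermComplex` given by `S.g`. -/
noncomputable def twoTermπ (S : ShortComplex C) :
    S.twoTermComplex ⟶ (ChainComplex.single₀ C).obj S.X₃ :=
  (ChainComplex.toSingle₀Equiv _ _).symm ⟨S.g, by
    rw [twoTermComplex_d_one_zero]; exact S.zero⟩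

lemma ShortExact.quasiIso_twoTermπ (hS : S.ShortExact) : _root_.QuasiIso S.twoTermπ := ⟨fun n => by
  cases n with
  | zero =>
    rw [ChainComplex.quasiIsoAt₀_iff, ShortComplex.quasiIso_iff_of_zeros' _ rfl rfl rfl]
    have h : S.twoTermπ.f 0 = S.g := ChainComplex.toSingle₀Equiv_symm_apply_f_zero _ _
    refine (ShortComplex.exact_and_epi_g_iff_of_iso (S₂ := S) ?_).2 ⟨hS.exact, hS.epi_g⟩
    refine ShortComplex.isoMk (Iso.refl _) (Iso.refl _) (Iso.refl _) ?_ ?_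
    · exact (Category.id_comp _).trans
        (S.twoTermComplex_d_one_zero.symm.trans (Category.comp_id _).symm)
    · exact (Category.id_comp _).trans (h.symm.trans (Category.comp_id _).symm)
  | succ n =>
    rw [quasiIsoAt_iff_exactAt' _ _ (ChainComplex.exactAt_succ_single_obj _ _)]
    exact hS.twoTermComplex_exactAt_succ n⟩

/-- A short exact sequence with projective first two terms is a projective resolution. -/
noncomputable def ShortExact.projectiveResolution (hS : S.ShortExact) [Projective S.X₁]
    [Projective S.X₂] : ProjectiveResolution S.X₃ where
  complex := S.twoTermComplex
  π := S.twoTermπ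
  quasiIso := hS.quasiIso_twoTermπ

end CategoryTheory.ShortComplex

/-- If the differential leaving degree `j` vanishes, then the homology in degree `j` is the cokernel
of the differential entering it. -/
lemma HomologicalComplex.exists_surjective_homology {R : Type*} [Ring R] {ι : Type*}
    {c : ComplexShape ι} (K : HomologicalComplex (ModuleCat R) c) {i j k : ι}
    (hi : c.prev j = i) (hk : c.next j = k) (h : K.d j k = 0) :
    ∃ φ : K.X j →+ K.homology j, Function.Surjective φ ∧
      ∀ x, φ x = 0 ↔ ∃ y, K.d i j y = x := by
  have hex : (ShortComplex.mk _ _ (K.d_pOpcycles i j)).Exact :=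
    ShortComplex.exact_of_g_is_cokernel _ (K.opcyclesIsCokernel i j hi)
  let e := K.isoHomologyι j k hk h
  refine ⟨(K.pOpcycles j ≫ e.inv).hom.toAddMonoidHom, ?_, fun x => ?_⟩
  · exact (ModuleCat.epi_iff_surjective (K.pOpcycles j ≫ e.inv)).1 inferInstance
  · have he : Function.Injective e.inv :=
      (ModuleCat.mono_iff_injective e.inv).1 inferInstance
    constructor
    · intro hx
      exact (ShortComplex.moduleCat_exact_iff _).1 hex x (he (hx.trans (map_zero e.inv.hom).symm))
    · rintro ⟨y, rfl⟩
      have := ConcreteCategory.congr_hom (K.d_pOpcycles i j) y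
      change e.inv.hom ((K.pOpcycles j).hom _) = 0
      erw [this]
      exact map_zero e.inv.hom

/-- A short exact sequence `0 ⟶ X₁ ⟶ X₂ ⟶ X₃ ⟶ 0` with `X₁` and `X₂` projective presents
`Ext¹(X₃, Y)` as the cokernel of `Hom(X₂, Y) ⟶ Hom(X₁, Y)`. -/
theorem CategoryTheory.ShortComplex.ShortExact.exists_surjective_ext_one {R : Type*} [Ring R]
    {C : Type*} [Category* C] [Abelian C] [Linear R C] [EnoughProjectives C]
    {S : ShortComplex C} (hS : S.ShortExact) [Projective S.X₁]
    [Projective S.X₂] (Y : C) :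
    ∃ φ : (S.X₁ ⟶ Y) →+ ((Ext R C 1).obj (Opposite.op S.X₃)).obj Y,
      Function.Surjective φ ∧ ∀ f, φ f = 0 ↔ ∃ g, S.f ≫ g = f := by
  let P := hS.projectiveResolution
  let K := P.complex.linearYonedaObj R Y
  have h10 : P.complex.d 1 0 = S.f := S.twoTermComplex_d_one_zero
  have hd : K.d 1 2 = 0 := by
    ext (f : P.complex.X 1 ⟶ Y)
    change P.complex.d 2 1 ≫ f = 0
    rw [show P.complex.d 2 1 = 0 from S.twoTermComplex_d_two_one, zero_comp]
  obtain ⟨φ, hφ, hφ'⟩ := K.exists_surjective_homology (i := 0) (j := 1) (k := 2)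
    (by simp) (by simp) hd
  let e := (P.isoExt (R := R) 1 Y).symm.toLinearEquiv.toAddEquiv
  refine ⟨e.toAddMonoidHom.comp φ, e.surjective.comp hφ, fun f => ?_⟩
  refine (map_eq_zero_iff e e.injective).trans ((hφ' f).trans ?_)
  change (∃ y : P.complex.X 0 ⟶ Y, P.complex.d 1 0 ≫ y = f) ↔ _
  rw [h10]
  rfl

/-- The class of `1 / p ^ (n + 1)` in the Prüfer `p`-group. -/
noncomputable def pruferGen {p : ℕ} (hp : p ≠ 0) (n : ℕ) : PruferGroup p :=
  ⟨QuotientAddGroup.mk (1 / (p : ℚ) ^ (n + 1)), n + 1, by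
    rw [← QuotientAddGroup.mk_nsmul, QuotientAddGroup.eq_zero_iff, nsmul_eq_mul]
    push_cast
    rw [mul_one_div_cancel (by positivity)]
    exact AddSubgroup.mem_zmultiples _⟩

/-- The projection from the free abelian group on `ℕ` onto the Prüfer `p`-group. -/
noncomputable def pruferProj {p : ℕ} (hp : p ≠ 0) : (ℕ →₀ ℤ) →ₗ[ℤ] PruferGroup p :=
  Finsupp.linearCombination ℤ (pruferGen hp)

/-- The relations `p e₀` and `p eₙ₊₁ - eₙ` between the generators of the Prüfer `p`-group. -/
noncomputable def pruferRel (p : ℕ) : (ℕ →₀ ℤ) →ₗ[ℤ] (ℕ →₀ ℤ) :=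
  (p : ℤ) • LinearMap.id - Finsupp.lcomapDomain Nat.succ Nat.succ_injective

lemma pruferRel_apply (p : ℕ) (f : ℕ →₀ ℤ) (n : ℕ) :
    pruferRel p f n = p * f n - f (n + 1) := by
  simp [pruferRel, Finsupp.lcomapDomain]

lemma pruferRel_single_zero (p : ℕ) :
    pruferRel p (Finsupp.single 0 1) = (p : ℤ) • Finsupp.single 0 1 := by
  ext n
  simp [pruferRel_apply, Finsupp.single_apply]

lemma pruferRel_single_succ (p n : ℕ) :
    pruferRel p (Finsupp.single (n + 1) 1) =
      (p : ℤ) • Finsupp.single (n + 1) 1 - Finsupp.single n 1 := by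
  ext k
  simp [pruferRel_apply, Finsupp.single_apply]

lemma pruferRel_injective {p : ℕ} (hp : p ≠ 0) : Function.Injective (pruferRel p) := by
  rw [injective_iff_map_eq_zero]
  intro f hf
  have hrec (n : ℕ) : f (n + 1) = p * f n := by
    have := pruferRel_apply p f n
    rw [hf, Finsupp.zero_apply] at this
    linarith
  have hpow (n : ℕ) : f n = p ^ n * f 0 := by
    induction n with
    | zero => simp
    | succ n ih => rw [hrec, ih, pow_succ]; ring
  obtain ⟨N, hN⟩ := Infinite.exists_notMem_finset f.support
  have h0 : f 0 = 0 := by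
    have := hpow N
    rw [Finsupp.notMem_support_iff.1 hN] at this
    have hp' : (p : ℤ) ^ N ≠ 0 := by positivity
    simpa [hp', hp] using this.symm
  ext n
  rw [hpow, h0, mul_zero, Finsupp.zero_apply]

lemma pruferProj_apply {p : ℕ} (hp : p ≠ 0) (f : ℕ →₀ ℤ) {N : ℕ}
    (hN : f.support ⊆ Finset.range N) :
    (pruferProj hp f : ℚ ⧸ AddSubgroup.zmultiples (1 : ℚ)) =
      QuotientAddGroup.mk (∑ i ∈ Finset.range N, (f i : ℚ) / (p : ℚ) ^ (i + 1)) := by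
  rw [pruferProj, Finsupp.linearCombination_apply, Finsupp.sum_of_support_subset f hN _ (by simp)]
  rw [AddSubgroup.val_finsetSum, QuotientAddGroup.mk_sum]
  refine Finset.sum_congr rfl fun i _ => ?_
  rw [div_eq_mul_one_div, ← zsmul_eq_mul, QuotientAddGroup.mk_zsmul]
  rfl

lemma pruferProj_surjective {p : ℕ} (hp : p ≠ 0) : Function.Surjective (pruferProj hp) := by
  rintro ⟨x, k, hk⟩
  obtain ⟨q, rfl⟩ := QuotientAddGroup.mk_surjective x
  rw [← QuotientAddGroup.mk_nsmul, QuotientAddGroup.eq_zero_iff] at hk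
  obtain ⟨m, hm⟩ := AddSubgroup.mem_zmultiples_iff.1 hk
  refine ⟨Finsupp.single k (m * p), ?_⟩
  rw [pruferProj, Finsupp.linearCombination_single]
  ext
  change (m * p) • (QuotientAddGroup.mk (1 / (p : ℚ) ^ (k + 1)) : ℚ ⧸ _) = _
  rw [← QuotientAddGroup.mk_zsmul]
  congr 1
  simp only [zsmul_eq_mul, nsmul_eq_mul, mul_one] at hm ⊢
  push_cast at hm ⊢
  have : (p : ℚ) ≠ 0 := by positivity
  rw [hm]
  field_simp
  ring

lemma exact_pruferRel_pruferProj {p : ℕ} (hp : p ≠ 0) :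
    Function.Exact (pruferRel p) (pruferProj hp) := by
  have hp' : (p : ℚ) ≠ 0 := by positivity
  rw [LinearMap.exact_iff]
  refine le_antisymm (fun f hf => ?_) ?_
  · obtain ⟨N, hN⟩ := f.support.exists_nat_subset_range
    have hsum := pruferProj_apply hp f hN
    rw [LinearMap.mem_ker.1 hf, ZeroMemClass.coe_zero, eq_comm,
      QuotientAddGroup.eq_zero_iff] at hsum
    obtain ⟨c, hc⟩ := AddSubgroup.mem_zmultiples_iff.1 hsum
    rw [zsmul_eq_mul, mul_one] at hc
    let g : ℕ → ℤ := fun n => Nat.rec (motive := fun _ => ℤ) c (fun n x => p * x - f n) n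
    have hg (n : ℕ) : (g n : ℚ) =
        p ^ n * (c - ∑ i ∈ Finset.range n, (f i : ℚ) / (p : ℚ) ^ (i + 1)) := by
      induction n with
      | zero => simp [g]
      | succ n ih =>
        have : g (n + 1) = p * g n - f n := rfl
        rw [this]
        push_cast
        rw [ih, Finset.sum_range_succ]
        field_simp
        ring
    have hg0 (n : ℕ) (hn : N ≤ n) : g n = 0 := by
      have : ∑ i ∈ Finset.range n, (f i : ℚ) / (p : ℚ) ^ (i + 1) = c := by
        rw [hc]
        refine (Finset.sum_subset (Finset.range_mono hn) fun i _ hi => ?_).symm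
        rw [Finsupp.notMem_support_iff.1 (fun h => hi (hN h))]
        simp
      have h := hg n
      rw [this, sub_self, mul_zero] at h
      exact_mod_cast h
    refine ⟨Finsupp.onFinset (Finset.range N) g fun n hn => ?_, ?_⟩
    · by_contra h
      exact hn (hg0 n (by simpa using h))
    · ext n
      rw [pruferRel_apply]
      change (p : ℤ) * g n - (p * g n - f n) = f n
      ring
  · rw [LinearMap.range_le_ker_iff]
    ext n
    have hgen (n : ℕ) : pruferProj hp (Finsupp.single n 1) = pruferGen hp n := by
      simp [pruferProj]
    simp only [LinearMap.comp_apply, Finsupp.lsingle_apply, LinearMap.zero_apply]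
    cases n with
    | zero =>
      rw [pruferRel_single_zero, map_zsmul, hgen]
      change (p : ℤ) • (QuotientAddGroup.mk (1 / (p : ℚ) ^ (0 + 1)) : ℚ ⧸ _) = 0
      rw [← QuotientAddGroup.mk_zsmul, QuotientAddGroup.eq_zero_iff]
      exact AddSubgroup.mem_zmultiples_iff.2 ⟨1, by simp [hp']⟩
    | succ n =>
      rw [pruferRel_single_succ, map_sub, map_zsmul, hgen, hgen]
      change (p : ℤ) • (QuotientAddGroup.mk (1 / (p : ℚ) ^ (n + 1 + 1)) : ℚ ⧸ _) -
        (QuotientAddGroup.mk (1 / (p : ℚ) ^ (n + 1)) : ℚ ⧸ _) = 0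
      rw [← QuotientAddGroup.mk_zsmul, sub_eq_zero]
      congr 1
      simp only [zsmul_eq_mul]
      push_cast
      field_simp
      ring

/-- `Ext(ℤ(p^∞), G)` is the quotient of `ℕ → G` by the image of
`g ↦ (p • g 0, p • g 1 - g 0, p • g 2 - g 1, …)`. -/
theorem exists_surjective_extPrufer {p : ℕ} (hp : p ≠ 0) (G : Type) [AddCommGroup G] :
    ∃ φ : (ℕ → G) →+ ExtPrufer p G, Function.Surjective φ ∧
      ∀ a, φ a = 0 ↔ ∃ g : ℕ → G, p • g 0 = a 0 ∧ ∀ n, p • g (n + 1) - g n = a (n + 1) := by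
  let S : ShortComplex (ModuleCat ℤ) :=
    ShortComplex.mk (ModuleCat.ofHom (pruferRel p)) (ModuleCat.ofHom (pruferProj hp))
      (ModuleCat.hom_ext (exact_pruferRel_pruferProj hp).linearMap_comp_eq_zero)
  have hS : S.ShortExact := ModuleCat.shortComplex_shortExact S
    (exact_pruferRel_pruferProj hp) (pruferRel_injective hp) (pruferProj_surjective hp)
  have hproj : Projective (ModuleCat.of ℤ (ℕ →₀ ℤ)) :=
    (IsProjective.iff_projective (R := ℤ) (ℕ →₀ ℤ)).1 inferInstance
  have : Projective S.X₁ := hproj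
  have : Projective S.X₂ := hproj
  obtain ⟨φ, hφ, hφ'⟩ := hS.exists_surjective_ext_one (R := ℤ) (ModuleCat.of ℤ G)
  let e : (ℕ → G) ≃+ (S.X₁ ⟶ ModuleCat.of ℤ G) :=
    (Finsupp.lift G ℤ ℕ).trans (ModuleCat.homAddEquiv (M := S.X₁) (N := ModuleCat.of ℤ G)).symm
  have he (a : ℕ → G) (n : ℕ) : (e a).hom (Finsupp.single n (1 : ℤ)) = a n := by
    change Finsupp.lift G ℤ ℕ a (Finsupp.single n 1) = a n
    simp
  have hcomp (a g : ℕ → G) : S.f ≫ e g = e a ↔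
      p • g 0 = a 0 ∧ ∀ n, p • g (n + 1) - g n = a (n + 1) := by
    have h0 : (S.f ≫ e g).hom (Finsupp.single 0 (1 : ℤ)) = p • g 0 := by
      change (e g).hom (pruferRel p (Finsupp.single 0 1)) = _
      rw [pruferRel_single_zero]
      erw [map_zsmul, he]
      exact natCast_zsmul _ _
    have hsucc (n : ℕ) : (S.f ≫ e g).hom (Finsupp.single (n + 1) (1 : ℤ)) =
        p • g (n + 1) - g n := by
      change (e g).hom (pruferRel p (Finsupp.single (n + 1) 1)) = _
      rw [pruferRel_single_succ]
      erw [map_sub, map_zsmul, he, he]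
      exact congrArg (· - g n) (natCast_zsmul _ _)
    constructor
    · intro h
      rw [h, he] at h0
      simp only [h, he] at hsucc
      exact ⟨h0.symm, fun n => (hsucc n).symm⟩
    · rintro ⟨ha0, hasucc⟩
      refine ModuleCat.hom_ext (Finsupp.lhom_ext' fun n => LinearMap.ext_ring ?_)
      change (S.f ≫ e g).hom (Finsupp.single n (1 : ℤ)) = (e a).hom (Finsupp.single n (1 : ℤ))
      rw [he]
      cases n with
      | zero => rw [h0, ha0]
      | succ n => rw [hsucc, hasucc]
  refine ⟨φ.comp e.toAddMonoidHom, hφ.comp e.surjective, fun a => ?_⟩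
  refine (hφ' (e a)).trans ⟨?_, ?_⟩
  · rintro ⟨f, hf⟩
    obtain ⟨g, rfl⟩ := e.surjective f
    exact ⟨g, (hcomp a g).1 hf⟩
  · rintro ⟨g, hg⟩
    exact ⟨e g, (hcomp a g).2 hg⟩

theorem ext_prufer_tfae (p : ℕ) (hp : p.Prime) (G : Type) [AddCommGroup G] :
    List.TFAE
      [∀ g : G, ∃ h : G, p • h = g,
        ∀ x : ExtPrufer p G, ∃ y : ExtPrufer p G, p • y = x,
        Subsingleton (ExtPrufer p G)] := by
  obtain ⟨φ, hφ, hφ'⟩ := exists_surjective_extPrufer hp.ne_zero G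
  tfae_have 1 → 3 := by
    intro hG
    choose d hd using hG
    refine subsingleton_of_forall_eq 0 fun x => ?_
    obtain ⟨a, rfl⟩ := hφ x
    let g : ℕ → G := fun n => Nat.rec (motive := fun _ => G) (d (a 0))
      (fun n x => d (a (n + 1) + x)) n
    exact (hφ' a).2 ⟨g, hd _, fun n => sub_eq_of_eq_add (hd (a (n + 1) + g n))⟩
  tfae_have 3 → 2 := fun _ x => ⟨0, Subsingleton.elim _ _⟩
  tfae_have 2 → 1 := by
    intro hE x
    obtain ⟨y, hy⟩ := hE (φ fun _ => x)
    obtain ⟨b, rfl⟩ := hφ y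
    rw [← map_nsmul, eq_comm, ← sub_eq_zero, ← map_sub, hφ'] at hy
    obtain ⟨g, hg, -⟩ := hy
    refine ⟨g 0 + b 0, ?_⟩
    rw [smul_add, hg]
    exact sub_add_cancel _ _
  tfae_finish
end

section
/- For every abelian group A and every prime p, the tensor product A ⊗_ℤ ℤ(p^∞) is zero if and only if the quotient group A/Tor_{p} A is p-divisible, where Tor_{p} A is the subgroup of elements of A of p-power order. -/
open scoped TensorProduct

/-- An element of `A` that dies in `A ⊗ ℚ` is torsion. -/
lemma exists_zsmul_eq_zero_of_one_tmul_eq_zero {A : Type} [AddCommGroup A] {a : A}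
    (h : (1 : ℚ) ⊗ₜ[ℤ] a = 0) : ∃ n : ℤ, n ≠ 0 ∧ n • a = 0 := by
  have hloc : IsLocalizedModule (nonZeroDivisors ℤ) (TensorProduct.mk ℤ ℚ A 1) :=
    (isLocalizedModule_iff_isBaseChange (nonZeroDivisors ℤ) ℚ _).2
      (TensorProduct.isBaseChange ℤ A ℚ)
  obtain ⟨c, hc⟩ := (IsLocalizedModule.eq_zero_iff (nonZeroDivisors ℤ)
    (TensorProduct.mk ℤ ℚ A 1)).1 h
  exact ⟨c, nonZeroDivisors.coe_ne_zero c, hc⟩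

/-- If `q⁻¹ ⊗ a` vanishes in `ℚ/ℤ ⊗ A`, then `a` is `q` times something, up to torsion. -/
lemma exists_torsion_sub_of_inv_tmul_eq_zero {A : Type} [AddCommGroup A] {a : A} {q : ℕ}
    (hq : q ≠ 0)
    (h : (QuotientAddGroup.mk ((q : ℚ)⁻¹) : ℚ ⧸ AddSubgroup.zmultiples (1 : ℚ)) ⊗ₜ[ℤ] a = 0) :
    ∃ (b : A) (n : ℤ), n ≠ 0 ∧ n • (a - q • b) = 0 := by
  let f : ℤ →ₗ[ℤ] ℚ := (Int.castAddHom ℚ).toIntLinearMap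
  let g : ℚ →ₗ[ℤ] ℚ ⧸ AddSubgroup.zmultiples (1 : ℚ) :=
    (QuotientAddGroup.mk' (AddSubgroup.zmultiples (1 : ℚ))).toIntLinearMap
  have hfg : Function.Exact f g := fun x ↦ by
    simp [f, g, AddSubgroup.mem_zmultiples_iff]
  have hex := rTensor_exact A hfg (QuotientAddGroup.mk'_surjective _)
  obtain ⟨z, hz⟩ := (hex ((q : ℚ)⁻¹ ⊗ₜ[ℤ] a)).1 h
  obtain ⟨b, rfl⟩ := (TensorProduct.lid ℤ A).symm.surjective z
  refine ⟨b, exists_zsmul_eq_zero_of_one_tmul_eq_zero ?_⟩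
  have hz' : (1 : ℚ) ⊗ₜ[ℤ] b = (q : ℚ)⁻¹ ⊗ₜ[ℤ] a := by simpa [f] using hz
  have hq' : (q : ℚ) ≠ 0 := Nat.cast_ne_zero.2 hq
  rw [TensorProduct.tmul_sub, TensorProduct.tmul_smul, hz', TensorProduct.smul_tmul',
    nsmul_eq_mul, mul_inv_cancel₀ hq', sub_self]

/-- If `a` is a multiple of `p` up to torsion, then it is one up to `p`-power torsion. -/
lemma exists_sub_mem_pTorsion {A : Type} [AddCommGroup A] {p : ℕ} (hp : p.Prime) {a b : A}
    {n : ℤ} (hn : n ≠ 0) (h : n • (a - p • b) = 0) : ∃ c : A, a - p • c ∈ pTorsion p A := by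
  have hfin : FiniteMultiplicity (p : ℤ) n :=
    Int.finiteMultiplicity_iff.2 ⟨by simpa using hp.ne_one, hn⟩
  obtain ⟨m, hnm, hm⟩ := hfin.exists_eq_pow_mul_and_not_dvd
  rw [hnm] at h
  generalize multiplicity (p : ℤ) n = k at h
  obtain ⟨u, v, huv⟩ :=
    (Prime.coprime_iff_not_dvd (Nat.prime_iff_prime_int.1 hp)).2 hm
  refine ⟨u • a + (v * m) • b, k, ?_⟩
  have key : a - p • (u • a + (v * m) • b) = (v * m) • (a - p • b) := by
    rw [← natCast_zsmul, ← natCast_zsmul]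
    have ha : a = (u * p + v * m) • a := by rw [huv, one_smul]
    nth_rewrite 1 [ha]
    module
  rw [key, ← natCast_zsmul, smul_smul]
  calc (((p ^ k : ℕ) : ℤ) * (v * m)) • (a - p • b)
      = v • ((p : ℤ) ^ k * m) • (a - p • b) := by
        rw [smul_smul]; congr 1; push_cast; ring
    _ = 0 := by rw [h, smul_zero]

/-- The Prüfer `p`-group is divisible by powers of `p`. -/
lemma PruferGroup.exists_pow_nsmul_eq {p : ℕ} (hp : p.Prime) (m : ℕ) (x : PruferGroup p) :
    ∃ y : PruferGroup p, p ^ m • y = x := by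
  obtain ⟨x, k, hk⟩ := x
  obtain ⟨r, rfl⟩ := QuotientAddGroup.mk_surjective x
  have hpm : (p : ℚ) ^ m ≠ 0 := pow_ne_zero _ (Nat.cast_ne_zero.2 hp.ne_zero)
  have hy : p ^ m • (QuotientAddGroup.mk (r / p ^ m) : ℚ ⧸ AddSubgroup.zmultiples (1 : ℚ)) =
      QuotientAddGroup.mk r := by
    rw [← QuotientAddGroup.mk_nsmul, nsmul_eq_mul, Nat.cast_pow, mul_div_cancel₀ _ hpm]
  exact ⟨⟨QuotientAddGroup.mk (r / p ^ m), k + m, by rw [pow_add, mul_smul, hy, hk]⟩,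
    Subtype.ext hy⟩

/-- The class of `p⁻¹` in the Prüfer `p`-group. -/
def PruferGroup.inv (p : ℕ) (hp : p ≠ 0) : PruferGroup p :=
  ⟨QuotientAddGroup.mk ((p : ℚ)⁻¹), 1, by
    rw [pow_one, ← QuotientAddGroup.mk_nsmul, nsmul_eq_mul,
      mul_inv_cancel₀ (Nat.cast_ne_zero.2 hp), QuotientAddGroup.eq_zero_iff]
    exact AddSubgroup.mem_zmultiples 1⟩

/-- Multiplication by `p` being surjective, so is multiplication by `p ^ k`. -/
lemma exists_pow_nsmul_eq_of_forall {B : Type*} [AddCommGroup B] {p : ℕ}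
    (h : ∀ x : B, ∃ y : B, p • y = x) (k : ℕ) (x : B) : ∃ y : B, p ^ k • y = x := by
  induction k generalizing x with
  | zero => exact ⟨x, by simp⟩
  | succ k ih =>
    obtain ⟨y, rfl⟩ := h x
    obtain ⟨z, rfl⟩ := ih y
    exact ⟨z, by rw [pow_succ', mul_smul]⟩

/-- `A ⊗_ℤ ℤ(p^∞) = 0` iff `A / Tor_p A` is `p`-divisible. -/
theorem tensor_prufer_eq_zero_iff_quotient_pDivisible (A : Type) [AddCommGroup A] (p : ℕ)
    (hp : p.Prime) :
    Subsingleton (TensorProduct ℤ A (PruferGroup p)) ↔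
      ∀ x : A ⧸ pTorsion p A, ∃ y : A ⧸ pTorsion p A, p • y = x := by
  constructor
  · intro hs x
    obtain ⟨a, rfl⟩ := QuotientAddGroup.mk_surjective x
    have h0 : a ⊗ₜ[ℤ] PruferGroup.inv p hp.ne_zero = 0 := Subsingleton.elim _ _
    have h1 := congrArg (TensorProduct.comm ℤ _ _)
      (congrArg (LinearMap.lTensor A (PruferGroup p).subtype.toIntLinearMap) h0)
    obtain ⟨b, n, hn, hb⟩ := exists_torsion_sub_of_inv_tmul_eq_zero (a := a) hp.ne_zero
      (by simpa [PruferGroup.inv] using h1)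
    obtain ⟨c, hc⟩ := exists_sub_mem_pTorsion hp hn hb
    refine ⟨QuotientAddGroup.mk c, ?_⟩
    rw [← QuotientAddGroup.mk_nsmul, QuotientAddGroup.eq, neg_add_eq_sub]
    exact hc
  · intro hdiv
    refine subsingleton_of_forall_eq 0 fun z ↦ ?_
    induction z with
    | zero => rfl
    | add x y hx hy => rw [hx, hy, add_zero]
    | tmul a q =>
      obtain ⟨k, hk⟩ := q.2
      have hk' : p ^ k • q = 0 := Subtype.ext hk
      obtain ⟨y, hy⟩ := exists_pow_nsmul_eq_of_forall hdiv k (QuotientAddGroup.mk a)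
      obtain ⟨b, rfl⟩ := QuotientAddGroup.mk_surjective y
      rw [← QuotientAddGroup.mk_nsmul, QuotientAddGroup.eq, neg_add_eq_sub] at hy
      obtain ⟨m, hm⟩ := hy
      obtain ⟨r, hr⟩ := PruferGroup.exists_pow_nsmul_eq hp m q
      have h1 : (a - p ^ k • b) ⊗ₜ[ℤ] q = 0 := by
        rw [← hr, ← TensorProduct.smul_tmul, hm, TensorProduct.zero_tmul]
      have h2 : (p ^ k • b) ⊗ₜ[ℤ] q = 0 := by
        rw [TensorProduct.smul_tmul, hk', TensorProduct.tmul_zero]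
      rw [← sub_add_cancel a (p ^ k • b), TensorProduct.add_tmul, h1, h2, add_zero]
end
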